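/- With F_q as defined via independent paired Gaussians, F₂(ρ) = (1/π)·(sin(arccos ρ) + (π - arccos ρ)·ρ) for all ρ ∈ [-1,1]. -/

import Mathlib

open MeasureTheory ProbabilityTheory Real

/-- `F_q(ρ) = E[max{h₁,…,h_q} ⬝ max{h₁',…,h_q'}]` where the pairs `(h_i, h_i')` are i.i.d.
bivariate standard normals with correlation `ρ`, realized as `h_i = z_i`,
`h_i' = ρ z_i + √(1-ρ²) w_i` for i.i.d. standard normals `z, w`. -/
noncomputable def Fq (q : ℕ) (ρ : ℝ) : ℝ :=
  ∫ p : (Fin q → ℝ) × (Fin q → ℝ),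
    (⨆ i, p.1 i) * (⨆ i, ρ * p.1 i + Real.sqrt (1 - ρ ^ 2) * p.2 i)
    ∂((Measure.pi fun _ : Fin q => gaussianReal 0 1).prod
        (Measure.pi fun _ : Fin q => gaussianReal 0 1))

lemma iSup_two (f : Fin 2 → ℝ) : (⨆ i, f i) = (f 0 + f 1 + |f 0 - f 1|) / 2 := by
  have h : (⨆ i, f i) = max (f 0) (f 1) := by
    apply le_antisymm
    · apply ciSup_le
      intro i
      fin_cases i
      · exact le_max_left _ _
      · exact le_max_right _ _
    · apply max_le
      · exact le_ciSup (Set.finite_range f).bddAbove 0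
      · exact le_ciSup (Set.finite_range f).bddAbove 1
  rw [h, max_def]
  split_ifs with h1
  · rw [abs_of_nonpos (by linarith)]; ring
  · rw [abs_of_nonneg (by linarith)]; ring

/-- the product of two standard Gaussians -/
noncomputable abbrev g2 : Measure (Fin 2 → ℝ) := Measure.pi fun _ : Fin 2 => gaussianReal 0 1

lemma indep_g2 : IndepFun (fun z : Fin 2 → ℝ => z 0) (fun z => z 1) g2 := by
  have h := iIndepFun_pi (μ := fun _ : Fin 2 => gaussianReal 0 1) (X := fun _ => (id : ℝ → ℝ))
    (fun _ => aemeasurable_id)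
  exact h.indepFun (i := 0) (j := 1) (by decide)

lemma mp_eval (i : Fin 2) : MeasurePreserving (fun z : Fin 2 → ℝ => z i) g2 (gaussianReal 0 1) :=
  measurePreserving_eval (fun _ : Fin 2 => gaussianReal 0 1) i

lemma mp_add : MeasurePreserving (fun z : Fin 2 → ℝ => z 0 + z 1) g2 (gaussianReal 0 2) := by
  refine ⟨by fun_prop, ?_⟩
  have h := gaussianReal_add_gaussianReal_of_indepFun indep_g2 (mp_eval 0).map_eq (mp_eval 1).map_eq
  rw [add_zero, one_add_one_eq_two] at h
  exact h

lemma mp_sub : MeasurePreserving (fun z : Fin 2 → ℝ => z 0 - z 1) g2 (gaussianReal 0 2) := by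
  refine ⟨by fun_prop, ?_⟩
  have h1 : g2.map (fun z => - z 1) = gaussianReal 0 1 := by
    have := gaussianReal_map_neg (μ := 0) (v := 1)
    rw [← (mp_eval 1).map_eq, Measure.map_map (by fun_prop) (by fun_prop), neg_zero] at this
    exact this
  have hi : IndepFun (fun z : Fin 2 → ℝ => z 0) (fun z => - z 1) g2 :=
    indep_g2.comp (φ := id) (ψ := fun x => -x) measurable_id measurable_neg
  have h := gaussianReal_add_gaussianReal_of_indepFun hi (mp_eval 0).map_eq h1
  rw [add_zero, one_add_one_eq_two] at h
  rw [← h]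
  congr 1

lemma mp_neg : MeasurePreserving (fun p : (Fin 2 → ℝ) × (Fin 2 → ℝ) => -p)
    (g2.prod g2) (g2.prod g2) := by
  have h1 : MeasurePreserving (fun x : ℝ => -x) (gaussianReal 0 1) (gaussianReal 0 1) :=
    ⟨measurable_neg, by simpa using gaussianReal_map_neg (μ := 0) (v := 1)⟩
  have h2 : MeasurePreserving (fun z : Fin 2 → ℝ => -z) g2 g2 :=
    measurePreserving_pi _ _ (fun _ => h1)
  exact h2.prod h2

lemma radial : ∫ r in Set.Ioi (0:ℝ), r ^ 3 * rexp (-(r ^ 2 / 4)) = 8 := by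
  have h := integral_rpow_mul_exp_neg_mul_rpow (p := 2) (q := 3) (b := 1/4)
    (by norm_num) (by norm_num) (by norm_num)
  have e : ∀ r : ℝ, r ^ 3 * rexp (-(r ^ 2 / 4)) = r ^ (3:ℝ) * rexp (-(1/4) * r ^ (2:ℝ)) := by
    intro r
    have h3 : r ^ (3:ℝ) = r ^ 3 := by exact_mod_cast rpow_natCast r 3
    have h2 : r ^ (2:ℝ) = r ^ 2 := by exact_mod_cast rpow_natCast r 2
    rw [h3, h2]; congr 2; ring
  simp_rw [e]
  rw [h]
  have : ((3:ℝ) + 1) / 2 = 2 := by norm_num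
  rw [neg_div, this, Real.Gamma_two, rpow_neg (by norm_num)]
  norm_num

lemma angular (θ : ℝ) (h0 : 0 ≤ θ) (h1 : θ ≤ π) :
    ∫ φ in (-π)..π, |cos φ| * |cos (φ - θ)| = 2 * (sin θ + (π / 2 - θ) * cos θ) := by
  have hper : Function.Periodic (fun φ => |cos φ| * |cos (φ - θ)|) π := by
    intro φ
    have : φ + π - θ = (φ - θ) + π := by ring
    simp only [this, cos_add_pi, abs_neg]
  have hc : Continuous (fun φ => |cos φ| * |cos (φ - θ)|) := by fun_prop
  have hi := fun a b => hc.intervalIntegrable (μ := volume) a b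
  have e1 := hper.intervalIntegral_add_eq (-π) (-(π/2))
  have e2 := hper.intervalIntegral_add_eq 0 (-(π/2))
  rw [show -π + π = 0 by ring, show -(π/2) + π = π/2 by ring] at e1
  rw [zero_add, show -(π/2) + π = π/2 by ring] at e2
  rw [← intervalIntegral.integral_add_adjacent_intervals (hi (-π) 0) (hi 0 π), e1, e2,
    ← intervalIntegral.integral_add_adjacent_intervals (hi (-(π/2)) (θ - π/2)) (hi (θ - π/2) (π/2))]
  have hd : ∀ x : ℝ, HasDerivAt (fun x => sin (2 * x - θ) / 4 + x * cos θ / 2)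
      (cos x * cos (x - θ)) x := by
    intro x
    have h := ((((hasDerivAt_id x).const_mul 2).sub_const θ).sin.div_const 4).add
      (((hasDerivAt_id x).mul_const (cos θ)).div_const 2)
    refine HasDerivAt.congr_deriv h ?_
    have a : 2 * x - θ = x + (x - θ) := by ring
    have b : cos θ = cos x * cos (x - θ) + sin x * sin (x - θ) := by
      rw [← cos_sub]; congr 1; ring
    simp only [id, a]
    rw [cos_add]; linear_combination (1/2) * b
  have hcc : Continuous (fun x => cos x * cos (x - θ)) := by fun_prop
  have I := fun a b => intervalIntegral.integral_eq_sub_of_hasDerivAt (a := a) (b := b)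
    (fun x _ => hd x) (hcc.intervalIntegrable (μ := volume) a b)
  have pa : ∫ φ in (-(π/2))..(θ - π/2), |cos φ| * |cos (φ - θ)|
      = - ∫ φ in (-(π/2))..(θ - π/2), cos φ * cos (φ - θ) := by
    rw [← intervalIntegral.integral_neg]
    apply intervalIntegral.integral_congr
    intro φ hφ
    rw [Set.uIcc_of_le (by linarith)] at hφ
    have c1 : 0 ≤ cos φ := cos_nonneg_of_neg_pi_div_two_le_of_le hφ.1 (by linarith [hφ.2])
    have c2 : cos (φ - θ) ≤ 0 := by
      rw [← cos_neg]
      exact cos_nonpos_of_pi_div_two_le_of_le (by linarith [hφ.2]) (by linarith [hφ.1])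
    simp only [abs_of_nonneg c1, abs_of_nonpos c2]; ring
  have pb : ∫ φ in (θ - π/2)..(π/2), |cos φ| * |cos (φ - θ)|
      = ∫ φ in (θ - π/2)..(π/2), cos φ * cos (φ - θ) := by
    apply intervalIntegral.integral_congr
    intro φ hφ
    rw [Set.uIcc_of_le (by linarith)] at hφ
    have c1 : 0 ≤ cos φ := cos_nonneg_of_neg_pi_div_two_le_of_le (by linarith [hφ.1]) hφ.2
    have c2 : 0 ≤ cos (φ - θ) :=
      cos_nonneg_of_neg_pi_div_two_le_of_le (by linarith [hφ.1]) (by linarith [hφ.2])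
    simp only [abs_of_nonneg c1, abs_of_nonneg c2]
  rw [pa, pb, I, I]
  have s1 : sin (2 * (π/2) - θ) = sin θ := by rw [mul_div_cancel₀ _ two_ne_zero, sin_pi_sub]
  have s2 : sin (2 * (-(π/2)) - θ) = sin θ := by
    rw [show 2 * (-(π/2)) - θ = -(θ + π) by ring, sin_neg, sin_add_pi, neg_neg]
  have s3 : sin (2 * (θ - π/2) - θ) = - sin θ := by
    rw [show 2 * (θ - π/2) - θ = θ - π by ring, sin_sub_pi]
  simp only [s1, s2, s3]
  ring

lemma gauss_prod_integral (f : ℝ × ℝ → ℝ) :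
    ∫ p, f p ∂((gaussianReal 0 2).prod (gaussianReal 0 2))
      = ∫ p : ℝ × ℝ, (1 / (4 * π) * rexp (-((p.1 ^ 2 + p.2 ^ 2) / 4))) * f p := by
  rw [gaussianReal_of_var_ne_zero 0 two_ne_zero,
    prod_withDensity (measurable_gaussianPDF _ _) (measurable_gaussianPDF _ _),
    integral_withDensity_eq_integral_toReal_smul
      (by have := measurable_gaussianPDF 0 2; fun_prop)
      (Filter.Eventually.of_forall fun p => ENNReal.mul_lt_top gaussianPDF_lt_top gaussianPDF_lt_top)]
  apply integral_congr_ae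
  refine Filter.Eventually.of_forall fun p => ?_
  simp only [ENNReal.toReal_mul, toReal_gaussianPDF, smul_eq_mul, gaussianPDFReal]
  congr 1
  have hs : √(2 * π * ((2:NNReal):ℝ)) * √(2 * π * ((2:NNReal):ℝ)) = 4 * π := by
    rw [mul_self_sqrt (by positivity)]; push_cast; ring
  rw [mul_mul_mul_comm, ← mul_inv, hs, ← exp_add, one_div]
  congr 2
  push_cast
  ring

lemma abs_integral (θ : ℝ) (h0 : 0 ≤ θ) (h1 : θ ≤ π) :
    ∫ p : ℝ × ℝ, |p.1| * |cos θ * p.1 + sin θ * p.2| ∂((gaussianReal 0 2).prod (gaussianReal 0 2))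
      = 4 / π * (sin θ + (π / 2 - θ) * cos θ) := by
  rw [gauss_prod_integral, ← integral_comp_polarCoord_symm]
  have e : ∀ p ∈ polarCoord.target, p.1 • ((1 / (4 * π) *
      rexp (-(((polarCoord.symm p).1 ^ 2 + (polarCoord.symm p).2 ^ 2) / 4))) *
      (|(polarCoord.symm p).1| * |cos θ * (polarCoord.symm p).1 + sin θ * (polarCoord.symm p).2|))
      = (1 / (4 * π) * (p.1 ^ 3 * rexp (-(p.1 ^ 2 / 4)))) * (|cos p.2| * |cos (p.2 - θ)|) := by
    rintro ⟨r, φ⟩ hp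
    have hr : 0 < r := hp.1
    simp only [polarCoord_symm_apply, smul_eq_mul]
    have a : (r * cos φ) ^ 2 + (r * sin φ) ^ 2 = r ^ 2 := by
      linear_combination r ^ 2 * (cos_sq_add_sin_sq φ)
    have b : cos θ * (r * cos φ) + sin θ * (r * sin φ) = r * cos (φ - θ) := by
      rw [cos_sub]; ring
    rw [a, b, abs_mul, abs_mul, abs_of_pos hr]
    ring
  rw [setIntegral_congr_fun polarCoord.open_target.measurableSet e, polarCoord_target,
    Measure.volume_eq_prod, setIntegral_prod_mul (fun r => 1 / (4 * π) * (r ^ 3 * rexp (-(r ^ 2 / 4))))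
      (fun φ => |cos φ| * |cos (φ - θ)|), integral_const_mul, radial,
    ← integral_Ioc_eq_integral_Ioo, ← intervalIntegral.integral_of_le (by linarith [pi_pos]),
    angular θ h0 h1]
  field_simp
  ring

lemma memLp_coord {v : NNReal} : MemLp (fun x : ℝ => x) 2 (gaussianReal 0 v) :=
  memLp_id_gaussianReal' 2 (by norm_num)

lemma lin_integral (c s : ℝ) :
    ∫ p : ℝ × ℝ, p.1 * (c * p.1 + s * p.2) ∂((gaussianReal 0 2).prod (gaussianReal 0 2))
      = 2 * c := by
  have hx : MemLp (fun p : ℝ × ℝ => p.1) 2 ((gaussianReal 0 2).prod (gaussianReal 0 2)) :=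
    memLp_coord.comp_measurePreserving measurePreserving_fst
  have hy : MemLp (fun p : ℝ × ℝ => p.2) 2 ((gaussianReal 0 2).prod (gaussianReal 0 2)) :=
    memLp_coord.comp_measurePreserving measurePreserving_snd
  have e : ∀ p : ℝ × ℝ, p.1 * (c * p.1 + s * p.2) = c * (p.1 * p.1) + s * (p.1 * p.2) := by
    intro p; ring
  simp_rw [e]
  have ixx : Integrable (fun p : ℝ × ℝ => p.1 * p.1)
      ((gaussianReal 0 2).prod (gaussianReal 0 2)) := hx.integrable_mul hx
  have ixy : Integrable (fun p : ℝ × ℝ => p.1 * p.2)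
      ((gaussianReal 0 2).prod (gaussianReal 0 2)) := hx.integrable_mul hy
  rw [integral_add (ixx.const_mul c) (ixy.const_mul s),
    integral_const_mul, integral_const_mul,
    integral_prod_mul (fun x : ℝ => x) (fun x : ℝ => x), integral_id_gaussianReal]
  have h2 : ∫ x, x * x ∂(gaussianReal 0 2) = 2 := by
    have := variance_fun_id_gaussianReal (μ := 0) (v := 2)
    rw [variance_eq_sub memLp_coord] at this
    simpa [integral_id_gaussianReal, pow_two] using this
  have h3 := integral_fun_fst (μ := gaussianReal 0 2) (ν := gaussianReal 0 2) (fun x : ℝ => x * x)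
  rw [h3, h2]
  simp
  ring

/-- `F₂(ρ) = (1/π)(sin(arccos ρ) + (π - arccos ρ) ρ)` for all `ρ ∈ [-1,1]`. -/
theorem F_two_closed_form (ρ : ℝ) (hρ : ρ ∈ Set.Icc (-1 : ℝ) 1) :
    Fq 2 ρ = (1 / π) * (Real.sin (Real.arccos ρ) + (π - Real.arccos ρ) * ρ) := by
  have hs : √(1 - ρ ^ 2) = sin (arccos ρ) := (sin_arccos ρ).symm
  have hc : cos (arccos ρ) = ρ := cos_arccos hρ.1 hρ.2
  unfold Fq
  rw [hs]
  have hθ0 := arccos_nonneg ρ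
  have hθ1 := arccos_le_pi ρ
  generalize arccos ρ = θ at *
  subst hc
  simp_rw [iSup_two]
  change ∫ p, _ ∂(g2.prod g2) = _
  set f : (Fin 2 → ℝ) × (Fin 2 → ℝ) → ℝ := fun p => (p.1 0 + p.1 1 + |p.1 0 - p.1 1|) / 2 *
    ((cos θ * p.1 0 + sin θ * p.2 0 + (cos θ * p.1 1 + sin θ * p.2 1) +
      |cos θ * p.1 0 + sin θ * p.2 0 - (cos θ * p.1 1 + sin θ * p.2 1)|) / 2) with hf
  have m1 : ∀ i, MemLp (fun p : (Fin 2 → ℝ) × (Fin 2 → ℝ) => p.1 i) 2 (g2.prod g2) := fun i =>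
    memLp_coord.comp_measurePreserving ((mp_eval i).comp measurePreserving_fst)
  have m2 : ∀ i, MemLp (fun p : (Fin 2 → ℝ) × (Fin 2 → ℝ) => p.2 i) 2 (g2.prod g2) := fun i =>
    memLp_coord.comp_measurePreserving ((mp_eval i).comp measurePreserving_snd)
  have m3 : ∀ i, MemLp (fun p : (Fin 2 → ℝ) × (Fin 2 → ℝ) => cos θ * p.1 i + sin θ * p.2 i) 2
      (g2.prod g2) := fun i => ((m1 i).const_mul _).add ((m2 i).const_mul _)
  have mM := (((m1 0).add (m1 1)).add ((m1 0).sub (m1 1)).norm).const_mul (1/2)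
  have mM' := (((m3 0).add (m3 1)).add ((m3 0).sub (m3 1)).norm).const_mul (1/2)
  have fi : Integrable f (g2.prod g2) := by
    refine (mM.integrable_mul mM').congr (Filter.Eventually.of_forall fun p => ?_)
    simp [hf]
    ring
  have hneg : ∫ p, f (-p) ∂(g2.prod g2) = ∫ p, f p ∂(g2.prod g2) :=
    mp_neg.integral_comp (MeasurableEquiv.neg _).measurableEmbedding f
  have fin : Integrable (fun p => f (-p)) (g2.prod g2) := mp_neg.integrable_comp_of_integrable fi
  have iA : Integrable (fun p : (Fin 2 → ℝ) × (Fin 2 → ℝ) => (p.1 0 + p.1 1) *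
      (cos θ * (p.1 0 + p.1 1) + sin θ * (p.2 0 + p.2 1))) (g2.prod g2) := by
    refine (((m1 0).add (m1 1)).integrable_mul ((m3 0).add (m3 1))).congr
      (Filter.Eventually.of_forall fun p => ?_)
    simp only [Pi.mul_apply, Pi.add_apply]
    ring
  have iB : Integrable (fun p : (Fin 2 → ℝ) × (Fin 2 → ℝ) => |p.1 0 - p.1 1| *
      |cos θ * (p.1 0 - p.1 1) + sin θ * (p.2 0 - p.2 1)|) (g2.prod g2) := by
    refine (((m1 0).sub (m1 1)).norm.integrable_mul ((m3 0).sub (m3 1)).norm).congr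
      (Filter.Eventually.of_forall fun p => ?_)
    simp
    left
    congr 1
    ring
  have vA : ∫ p : (Fin 2 → ℝ) × (Fin 2 → ℝ), (p.1 0 + p.1 1) *
      (cos θ * (p.1 0 + p.1 1) + sin θ * (p.2 0 + p.2 1)) ∂(g2.prod g2) = 2 * cos θ := by
    rw [← lin_integral (cos θ) (sin θ), ← (mp_add.prod mp_add).map_eq,
      integral_map (mp_add.prod mp_add).aemeasurable (by fun_prop)]
    rfl
  have vB : ∫ p : (Fin 2 → ℝ) × (Fin 2 → ℝ), |p.1 0 - p.1 1| *
      |cos θ * (p.1 0 - p.1 1) + sin θ * (p.2 0 - p.2 1)| ∂(g2.prod g2)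
      = 4 / π * (sin θ + (π / 2 - θ) * cos θ) := by
    rw [← abs_integral θ hθ0 hθ1, ← (mp_sub.prod mp_sub).map_eq,
      integral_map (mp_sub.prod mp_sub).aemeasurable
        (Continuous.aestronglyMeasurable (by fun_prop))]
    rfl
  have key : ∫ p, (f p + f (-p)) ∂(g2.prod g2) = ∫ p : (Fin 2 → ℝ) × (Fin 2 → ℝ),
      (1 / 2 * ((p.1 0 + p.1 1) * (cos θ * (p.1 0 + p.1 1) + sin θ * (p.2 0 + p.2 1))) +
      1 / 2 * (|p.1 0 - p.1 1| * |cos θ * (p.1 0 - p.1 1) + sin θ * (p.2 0 - p.2 1)|))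
      ∂(g2.prod g2) := by
    congr 1
    ext p
    simp only [hf, Prod.fst_neg, Prod.snd_neg, Pi.neg_apply]
    have a1 : |-p.1 0 - -p.1 1| = |p.1 0 - p.1 1| := by rw [← abs_neg]; congr 1; ring
    have a2 : |cos θ * -p.1 0 + sin θ * -p.2 0 - (cos θ * -p.1 1 + sin θ * -p.2 1)|
      = |cos θ * (p.1 0 - p.1 1) + sin θ * (p.2 0 - p.2 1)| := by rw [← abs_neg]; congr 1; ring
    have a3 : |cos θ * p.1 0 + sin θ * p.2 0 - (cos θ * p.1 1 + sin θ * p.2 1)|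
      = |cos θ * (p.1 0 - p.1 1) + sin θ * (p.2 0 - p.2 1)| := by congr 1; ring
    rw [a1, a2, a3]
    ring
  rw [integral_add fi fin, hneg, integral_add (iA.const_mul _) (iB.const_mul _),
    integral_const_mul, integral_const_mul, vA, vB] at key
  have : ∫ p, f p ∂(g2.prod g2) = (1/2) * (1 / 2 * (2 * cos θ) +
    1 / 2 * (4 / π * (sin θ + (π / 2 - θ) * cos θ))) := by linarith
  rw [this]
  field_simp
  ring
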